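/- Let λ be distributed according to the Hilbert–Schmidt ensemble of dimension n with parameter α ≥ 0, i.e., the density proportional to δ(1 − ∑λ_i) ∏ λ_i^α ∏_{i<j}(λ_i−λ_j)² on the simplex. Then the average purity satisfies E[∑_i λ_i²] = (2n+α)/(n(n+α)+1). -/

import Mathlib

open Finset

/-- Extend `y : Fin m → ℝ` to `Fin (m+1) → ℝ` by appending `1 - ∑ y` (the fixed-trace
parametrization of the simplex). -/
noncomputable def simplexExt (m : ℕ) (y : Fin m → ℝ) : Fin (m + 1) → ℝ :=
  Fin.snoc y (1 - ∑ i, y i)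

/-- Unnormalized Hilbert–Schmidt density in the simplex parametrization:
`∏ λ_i^α ∏_{i<j} (λ_i - λ_j)²` on `{λ_i ≥ 0}`, with `λ = simplexExt m y`. -/
noncomputable def hsDensity (m : ℕ) (α : ℝ) (y : Fin m → ℝ) : ℝ :=
  Set.indicator {y : Fin m → ℝ | ∀ i, 0 ≤ simplexExt m y i}
    (fun y =>
      (∏ i, simplexExt m y i ^ α) *
        ∏ i, ∏ j ∈ Finset.Ioi i, (simplexExt m y i - simplexExt m y j) ^ 2) y

open MeasureTheory in
lemma real_beta (a b : ℝ) (ha : 0 ≤ a) (hb : 0 ≤ b) :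
    ∫ s in Set.Ioo (0:ℝ) 1, s ^ a * (1 - s) ^ b =
      Real.Gamma (a + 1) * Real.Gamma (b + 1) / Real.Gamma (a + b + 2) := by
  have h := ProbabilityTheory.beta_eq_betaIntegralReal (a+1) (b+1) (by linarith) (by linarith)
  unfold ProbabilityTheory.beta at h
  rw [show a + b + 2 = a + 1 + (b + 1) by ring, h, Complex.betaIntegral,
    intervalIntegral.integral_of_le zero_le_one, integral_Ioc_eq_integral_Ioo]
  have : ∀ s ∈ Set.Ioo (0:ℝ) 1, (s:ℂ) ^ (((a+1:ℝ):ℂ) - 1) * (1 - (s:ℂ)) ^ (((b+1:ℝ):ℂ) - 1)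
      = ((s ^ a * (1 - s) ^ b : ℝ) : ℂ) := by
    intro s hs
    push_cast
    rw [add_sub_cancel_right, add_sub_cancel_right, Complex.ofReal_cpow hs.1.le,
      Complex.ofReal_cpow (by linarith [hs.2])]
    simp
  rw [setIntegral_congr_fun measurableSet_Ioo this, integral_complex_ofReal, Complex.ofReal_re]

lemma simplexExt_castSucc (m : ℕ) (y : Fin m → ℝ) (i : Fin m) :
    simplexExt m y i.castSucc = y i := by simp [simplexExt]

lemma simplexExt_last (m : ℕ) (y : Fin m → ℝ) :
    simplexExt m y (Fin.last m) = 1 - ∑ i, y i := by simp [simplexExt]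

lemma sum_simplexExt (m : ℕ) (y : Fin m → ℝ) : ∑ i, simplexExt m y i = 1 := by
  rw [Fin.sum_univ_castSucc]; simp [simplexExt_castSucc, simplexExt_last]

lemma simplexExt_cons_zero (m : ℕ) (s : ℝ) (z : Fin m → ℝ) :
    simplexExt (m+1) (Fin.cons s z : Fin (m+1) → ℝ) 0 = s := by
  have := simplexExt_castSucc (m+1) (Fin.cons s z : Fin (m+1) → ℝ) 0
  simpa using this

lemma simplexExt_cons_succ (m : ℕ) (s : ℝ) (y : Fin m → ℝ) (i : Fin (m+1)) :
    simplexExt (m+1) (Fin.cons s ((1-s) • y) : Fin (m+1) → ℝ) i.succ =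
      (1 - s) * simplexExt m y i := by
  induction i using Fin.lastCases with
  | last =>
    rw [Fin.succ_last, simplexExt_last, simplexExt_last, Fin.sum_univ_succ]
    simp [← Finset.mul_sum]; ring
  | cast i =>
    rw [Fin.succ_castSucc, simplexExt_castSucc, simplexExt_castSucc]
    simp

lemma measurable_simplexExt (m : ℕ) (i : Fin (m+1)) : Measurable fun y => simplexExt m y i := by
  induction i using Fin.lastCases with
  | last => simp only [simplexExt_last]; fun_prop
  | cast i => simp only [simplexExt_castSucc]; fun_prop

noncomputable def dirF (m : ℕ) (e : Fin (m+1) → ℝ) (y : Fin m → ℝ) : ℝ :=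
  Set.indicator {y : Fin m → ℝ | ∀ i, 0 ≤ simplexExt m y i}
    (fun y => ∏ i, simplexExt m y i ^ e i) y

lemma measurableSet_simplex (m : ℕ) : 
    MeasurableSet {y : Fin m → ℝ | ∀ i, 0 ≤ simplexExt m y i} := by
  rw [Set.ofPred_forall]
  exact MeasurableSet.iInter fun i => measurableSet_le measurable_const (measurable_simplexExt m i)

lemma simplexExt_le_one (m : ℕ) (y : Fin m → ℝ) (h : ∀ i, 0 ≤ simplexExt m y i) (i) :
    simplexExt m y i ≤ 1 := by
  rw [← sum_simplexExt m y]
  exact Finset.single_le_sum (fun j _ => h j) (Finset.mem_univ i)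

open MeasureTheory in
lemma integrable_dirF (m : ℕ) (e : Fin (m+1) → ℝ) (he : ∀ i, 0 ≤ e i) :
    Integrable (dirF m e) := by
  have hg : Integrable (Set.indicator (Set.Icc (0 : Fin m → ℝ) 1) fun _ => (1:ℝ)) := by
    rw [integrable_indicator_iff measurableSet_Icc]
    exact integrableOn_const (isCompact_Icc.measure_lt_top.ne)
  refine hg.mono' ?_ (Filter.Eventually.of_forall fun y => ?_)
  · refine Measurable.aestronglyMeasurable ?_
    refine Measurable.indicator ?_ (measurableSet_simplex m)
    exact Finset.measurable_prod _ fun i _ => (measurable_simplexExt m i).pow_const _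
  · unfold dirF
    by_cases h : y ∈ {y : Fin m → ℝ | ∀ i, 0 ≤ simplexExt m y i}
    · have h2 : y ∈ Set.Icc (0 : Fin m → ℝ) 1 := by
        constructor
        · intro i; have := h i.castSucc; rwa [simplexExt_castSucc] at this
        · intro i; have := simplexExt_le_one m y h i.castSucc; rwa [simplexExt_castSucc] at this
      rw [Set.indicator_of_mem h, Set.indicator_of_mem h2, Real.norm_eq_abs, abs_of_nonneg]
      · exact Finset.prod_le_one (fun i _ => Real.rpow_nonneg (h i) _)
          fun i _ => Real.rpow_le_one (h i) (simplexExt_le_one m y h i) (he i)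
      · exact Finset.prod_nonneg (fun i _ => Real.rpow_nonneg (h i) _)
    · rw [Set.indicator_of_notMem h, norm_zero]
      exact Set.indicator_nonneg (fun _ _ => zero_le_one) _

lemma dirF_cons (m : ℕ) (e : Fin (m+2) → ℝ) (s : ℝ) (hs : s ∈ Set.Ioo (0:ℝ) 1) (y : Fin m → ℝ) :
    dirF (m+1) e (Fin.cons s ((1-s) • y) : Fin (m+1) → ℝ) =
      (s ^ e 0 * (1-s) ^ (∑ i : Fin (m+1), e i.succ)) * dirF m (fun i => e i.succ) y := by
  have h1 : 0 < 1 - s := by linarith [hs.2]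
  have hiff : (∀ i, 0 ≤ simplexExt (m+1) (Fin.cons s ((1-s) • y) : Fin (m+1) → ℝ) i) ↔
      ∀ i, 0 ≤ simplexExt m y i := by
    rw [Fin.forall_fin_succ]
    simp only [simplexExt_cons_zero, simplexExt_cons_succ, hs.1.le, true_and,
      mul_nonneg_iff_of_pos_left h1]
  unfold dirF
  by_cases h : ∀ i, 0 ≤ simplexExt m y i
  · rw [Set.indicator_of_mem (by exact hiff.2 h), Set.indicator_of_mem (by exact h),
      Fin.prod_univ_succ]
    simp only [simplexExt_cons_zero, simplexExt_cons_succ]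
    rw [Real.rpow_sum_of_pos h1, mul_assoc, ← Finset.prod_mul_distrib]
    congr 1
    exact Finset.prod_congr rfl fun i _ => Real.mul_rpow h1.le (h i)
  · rw [Set.indicator_of_notMem (by exact fun h' => h (hiff.1 h')), Set.indicator_of_notMem (by exact h),
      mul_zero]

lemma dirF_cons_zero (m : ℕ) (e : Fin (m+2) → ℝ) (s : ℝ) (hs : s ∉ Set.Icc (0:ℝ) 1)
    (y : Fin m → ℝ) : dirF (m+1) e (Fin.cons s y : Fin (m+1) → ℝ) = 0 := by
  unfold dirF
  refine Set.indicator_of_notMem (fun h => hs ?_) _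
  have h1 := h 0
  have h2 := simplexExt_le_one _ _ h 0
  rw [simplexExt_cons_zero] at h1 h2
  exact ⟨h1, h2⟩

open MeasureTheory in
lemma inner_integral (m : ℕ) (e : Fin (m+2) → ℝ) (s : ℝ) (hs : s ∈ Set.Ioo (0:ℝ) 1) :
    ∫ z : Fin m → ℝ, dirF (m+1) e (Fin.cons s z : Fin (m+1) → ℝ) =
      (s ^ e 0 * (1-s) ^ (∑ i : Fin (m+1), e i.succ + m)) * ∫ y, dirF m (fun i => e i.succ) y := by
  have h1 : 0 < 1 - s := by linarith [hs.2]
  have := Measure.integral_comp_smul (volume : Measure (Fin m → ℝ))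
    (fun z => dirF (m+1) e (Fin.cons s z : Fin (m+1) → ℝ)) (1 - s)
  simp only [dirF_cons m e s hs] at this
  rw [integral_const_mul, Module.finrank_fin_fun, abs_of_pos (by positivity), smul_eq_mul,
    eq_inv_mul_iff_mul_eq₀ (by positivity)] at this
  rw [← this, Real.rpow_add h1, Real.rpow_natCast]
  ring

open MeasureTheory in
lemma dirichlet (m : ℕ) : ∀ (e : Fin (m+1) → ℝ), (∀ i, 0 ≤ e i) →
    ∫ y, dirF m e y = (∏ i, Real.Gamma (e i + 1)) / Real.Gamma (∑ i, e i + (m + 1)) := by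
  induction m with
  | zero =>
    intro e he
    have h1 : ∀ i y, simplexExt 0 y i = 1 := by
      intro i y
      rw [show i = Fin.last 0 from Fin.ext (by simp), simplexExt_last]; simp
    have : ∀ y, dirF 0 e y = 1 := by
      intro y; simp [dirF, h1]
    simp only [this]
    have : Real.Gamma (e 0 + 1) ≠ 0 := (Real.Gamma_pos_of_pos (by linarith [he 0])).ne'
    simp [this, Measure.real, volume_pi, Measure.pi_of_empty]
  | succ m ih =>
    intro e he
    have hmp := (volume_preserving_piFinSuccAbove (fun _ : Fin (m+1) => ℝ) 0).symm
    have hint := integrable_dirF (m+1) e he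
    have hcons : ∀ p : ℝ × (Fin m → ℝ), (MeasurableEquiv.piFinSuccAbove
        (fun _ : Fin (m+1) => ℝ) 0).symm p = (Fin.cons p.1 p.2 : Fin (m+1) → ℝ) := by
      intro p
      simp [MeasurableEquiv.piFinSuccAbove, Fin.insertNthEquiv]
    rw [← hmp.integral_comp' (dirF (m+1) e)]
    have hint2 := (hmp.integrable_comp_emb (MeasurableEquiv.measurableEmbedding _)).2 hint
    simp only [Function.comp_def, hcons] at hint2 ⊢
    rw [show (volume : Measure (ℝ × (Fin m → ℝ))) = volume.prod volume from rfl] at hint2 ⊢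
    rw [integral_prod _ hint2]
    have hz : ∀ s ∉ Set.Icc (0:ℝ) 1,
        ∫ z : Fin m → ℝ, dirF (m+1) e (Fin.cons s z : Fin (m+1) → ℝ) = 0 := by
      intro s hs
      simp [dirF_cons_zero m e s hs]
    rw [← setIntegral_eq_integral_of_forall_compl_eq_zero hz, integral_Icc_eq_integral_Ioo,
      setIntegral_congr_fun measurableSet_Ioo (fun s hs => inner_integral m e s hs),
      integral_mul_const, real_beta _ _ (he 0)
        (add_nonneg (Finset.sum_nonneg fun i _ => he _) (Nat.cast_nonneg _)),
      ih _ (fun i => he _), Fin.prod_univ_succ (f := fun i => Real.Gamma (e i + 1)), Fin.sum_univ_succ (f := e)]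
    have hp : (0:ℝ) < ∑ i : Fin (m+1), e i.succ + (m + 1) := by
      have : 0 ≤ ∑ i : Fin (m+1), e i.succ := Finset.sum_nonneg fun i _ => he _
      positivity
    have := (Real.Gamma_pos_of_pos hp).ne'
    rw [add_assoc _ (m:ℝ) 1]
    push_cast
    rw [show e 0 + (∑ i : Fin (m+1), e i.succ + (m:ℝ)) + 2
      = e 0 + ∑ i : Fin (m+1), e i.succ + (m + 1 + 1) by ring]
    field_simp

open MvPolynomial in
lemma eval_monomial_mul (m : ℕ) (α : ℝ) (hα : 0 ≤ α) (k : Fin (m+1) →₀ ℕ) (a : ℝ) (y : Fin m → ℝ) :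
    eval (simplexExt m y) (monomial k a) * dirF m (fun _ => α) y =
      a * dirF m (fun i => α + k i) y := by
  unfold dirF
  by_cases h : y ∈ {y : Fin m → ℝ | ∀ i, 0 ≤ simplexExt m y i}
  · rw [Set.indicator_of_mem h, Set.indicator_of_mem h, eval_monomial,
      Finsupp.prod_fintype _ _ (by simp), mul_assoc, ← Finset.prod_mul_distrib]
    congr 1
    refine Finset.prod_congr rfl fun i _ => ?_
    rw [Real.rpow_add_of_nonneg (h i) hα (Nat.cast_nonneg _), Real.rpow_natCast, mul_comm]
  · rw [Set.indicator_of_notMem h, Set.indicator_of_notMem h]; simp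

open MeasureTheory MvPolynomial in
lemma integrable_poly (m : ℕ) (α : ℝ) (hα : 0 ≤ α) (P : MvPolynomial (Fin (m+1)) ℝ) :
    Integrable fun y => eval (simplexExt m y) P * dirF m (fun _ => α) y := by
  induction P using MvPolynomial.induction_on' with
  | monomial k a =>
    simp only [eval_monomial_mul m α hα]
    exact (integrable_dirF m _ fun i => by positivity).const_mul a
  | add p q hp hq =>
    simp only [map_add, add_mul]
    exact hp.add hq

open MeasureTheory MvPolynomial in
noncomputable def SS (m : ℕ) (α : ℝ) (hα : 0 ≤ α) : MvPolynomial (Fin (m+1)) ℝ →ₗ[ℝ] ℝ where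
  toFun P := ∫ y, eval (simplexExt m y) P * dirF m (fun _ => α) y
  map_add' P Q := by
    simp only [map_add, add_mul]
    exact integral_add (integrable_poly m α hα P) (integrable_poly m α hα Q)
  map_smul' c P := by
    simp only [smul_eval, mul_assoc, RingHom.id_apply, smul_eq_mul]
    exact integral_const_mul _ _

open MeasureTheory MvPolynomial in
lemma SS_apply (m : ℕ) (α : ℝ) (hα : 0 ≤ α) (P : MvPolynomial (Fin (m+1)) ℝ) :
    SS m α hα P = ∫ y, eval (simplexExt m y) P * dirF m (fun _ => α) y := rfl

open MvPolynomial in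
lemma SS_monomial (m : ℕ) (α : ℝ) (hα : 0 ≤ α) (k : Fin (m+1) →₀ ℕ) (a : ℝ) :
    SS m α hα (monomial k a) = a * ((∏ i, Real.Gamma (α + k i + 1)) /
      Real.Gamma (∑ i, (α + k i) + (m + 1))) := by
  rw [SS_apply]
  simp only [eval_monomial_mul m α hα]
  rw [MeasureTheory.integral_const_mul, dirichlet _ _ fun i => by positivity]

open MvPolynomial in
lemma X_mul_pd (n : ℕ) (i : Fin n) (k : Fin n →₀ ℕ) (a : ℝ) :
    X i * pderiv i (monomial k a) = (k i : ℝ) • monomial k a := by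
  rw [X_mul_pderiv_monomial, Nat.cast_smul_eq_nsmul]

open MvPolynomial in
lemma SS_X_mul (m : ℕ) (α : ℝ) (hα : 0 ≤ α) (i : Fin (m+1)) (k : Fin (m+1) →₀ ℕ) (a : ℝ) :
    (∑ j, (k j : ℝ) + (m+1) * (α + 1)) * SS m α hα (X i * monomial k a) =
      (α + k i + 1) * SS m α hα (monomial k a) := by
  have hX : X i * monomial k a = monomial (k + Finsupp.single i 1) a := by
    rw [X, monomial_mul, one_mul, add_comm k]
  rw [hX, SS_monomial, SS_monomial]
  have h1 : ∑ j, (α + ((k + Finsupp.single i 1 : Fin (m+1) →₀ ℕ) j : ℝ)) + ((m:ℝ) + 1) =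
      (∑ j, (α + (k j : ℝ)) + (m + 1)) + 1 := by
    have : ∀ j, α + ((k + Finsupp.single i 1 : Fin (m+1) →₀ ℕ) j : ℝ) =
        (α + (k j : ℝ)) + if i = j then 1 else 0 := by
      intro j; simp [Finsupp.single_apply]; ring
    simp only [this]
    rw [Finset.sum_add_distrib]; simp; ring
  have hpos : (0:ℝ) < ∑ j, (α + (k j : ℝ)) + (m + 1) := by
    have : 0 ≤ ∑ j, (α + (k j : ℝ)) := Finset.sum_nonneg fun j _ => by positivity
    positivity
  have h2 : ∏ j, Real.Gamma (α + ((k + Finsupp.single i 1 : Fin (m+1) →₀ ℕ) j : ℝ) + 1) =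
      (α + k i + 1) * ∏ j, Real.Gamma (α + k j + 1) := by
    have : ∀ j, Real.Gamma (α + ((k + Finsupp.single i 1 : Fin (m+1) →₀ ℕ) j : ℝ) + 1) =
        (if i = j then (α + k i + 1) else 1) * Real.Gamma (α + k j + 1) := by
      intro j
      by_cases h : i = j
      · subst h
        have h0 : α + (k i : ℝ) + 1 ≠ 0 := by positivity
        simp only [Finsupp.add_apply, Finsupp.single_eq_same, if_true, Nat.cast_add, Nat.cast_one]
        rw [← Real.Gamma_add_one h0]; congr 1; ring
      · simp [Finsupp.single_apply, h]
    simp only [this]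
    rw [Finset.prod_mul_distrib]; simp
  rw [h1, h2, Real.Gamma_add_one hpos.ne']
  have hG := (Real.Gamma_pos_of_pos hpos).ne'
  have h3 : ∑ j, (k j : ℝ) + (m+1) * (α + 1) = ∑ j, (α + (k j : ℝ)) + (m + 1) := by
    rw [Finset.sum_add_distrib]; simp; ring
  rw [h3]
  have := hpos.ne'
  field_simp

open MvPolynomial in
lemma SS_key (m : ℕ) (α : ℝ) (hα : 0 ≤ α) (i : Fin (m+1)) (P : MvPolynomial (Fin (m+1)) ℝ) :
    SS m α hα (X i * (∑ j, X j * pderiv j P + ((m+1) * (α + 1)) • P)) =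
      SS m α hα ((α + 1) • P + X i * pderiv i P) := by
  induction P using MvPolynomial.induction_on' with
  | monomial k a =>
    have h := SS_X_mul m α hα i k a
    simp only [X_mul_pd]
    rw [← Finset.sum_smul, ← add_smul, ← add_smul, mul_smul_comm, map_smul, map_smul, smul_eq_mul,
      smul_eq_mul, h]
    ring
  | add p q hp hq =>
    have e1 : X i * (∑ j, X j * pderiv j (p + q) + (((m:ℝ)+1) * (α + 1)) • (p + q)) =
      X i * (∑ j, X j * pderiv j p + (((m:ℝ)+1) * (α + 1)) • p) +
      X i * (∑ j, X j * pderiv j q + (((m:ℝ)+1) * (α + 1)) • q) := by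
      simp only [map_add, mul_add, Finset.sum_add_distrib, smul_add]; ring
    have e2 : (α + 1) • (p + q) + X i * pderiv i (p + q) =
      ((α + 1) • p + X i * pderiv i p) + ((α + 1) • q + X i * pderiv i q) := by
      simp only [map_add, mul_add, smul_add]; ring
    rw [e1, e2, map_add, map_add, hp, hq]

lemma deriv_prod_eigen {ι R A : Type*} [CommRing R] [CommRing A] [Algebra R A]
    (D : Derivation R A A) (s : Finset ι) (f c : ι → A) (h : ∀ i ∈ s, D (f i) = c i * f i) :
    D (∏ i ∈ s, f i) = (∑ i ∈ s, c i) * ∏ i ∈ s, f i := by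
  classical
  induction s using Finset.induction_on with
  | empty => simp
  | insert a s ha ih =>
    rw [Finset.prod_insert ha, Finset.sum_insert ha, D.leibniz, ih fun i hi => h i (by simp [hi]),
      h a (by simp)]
    simp only [smul_eq_mul]; ring

lemma sum_pairs {R : Type*} [CommRing R] (n : ℕ) (f : Fin n → R) :
    ∑ i, ∑ j ∈ Finset.Ioi i, (f i + f j) + ∑ i, f i = n * ∑ i, f i := by
  induction n with
  | zero => simp
  | succ n ih =>
    have := ih (fun i => f i.succ)
    rw [Fin.sum_univ_succ, Fin.sum_univ_succ (f := f), Fin.sum_Ioi_zero]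
    simp only [Fin.sum_Ioi_succ]
    rw [Finset.sum_add_distrib (f := fun _ => f 0)]
    simp only [Finset.sum_const, Finset.card_univ, Fintype.card_fin, nsmul_eq_mul, Nat.cast_succ]
    linear_combination this

open MvPolynomial in
noncomputable def VV (n : ℕ) : MvPolynomial (Fin n) ℝ :=
  ∏ i, ∏ j ∈ Finset.Ioi i, (X i - X j) ^ 2

open MvPolynomial in
lemma mkD_eq (n : ℕ) (g : Fin n → MvPolynomial (Fin n) ℝ) (P : MvPolynomial (Fin n) ℝ) :
    ∑ i, g i * pderiv i P = mkDerivation ℝ g P := by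
  have : mkDerivation ℝ g = ∑ i, g i • pderiv i := by
    apply derivation_ext
    intro j
    rw [mkDerivation_X, ← Derivation.coeFnAddMonoidHom_apply, map_sum, Finset.sum_apply]
    simp [Derivation.coeFnAddMonoidHom_apply, pderiv_X, Pi.single_apply]
  rw [this, ← Derivation.coeFnAddMonoidHom_apply, map_sum, Finset.sum_apply]
  simp [Derivation.coeFnAddMonoidHom_apply]

open MvPolynomial in
lemma euler_VV (n : ℕ) :
    ∑ i, X i * pderiv i (VV n) + (n : MvPolynomial (Fin n) ℝ) * VV n = (n * n) * VV n := by
  rw [mkD_eq, VV, deriv_prod_eigen _ _ _ (fun i => ∑ j ∈ Finset.Ioi i, (1 + 1))]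
  · have := sum_pairs n (fun _ => (1 : MvPolynomial (Fin n) ℝ))
    simp only [Finset.sum_const (1 : MvPolynomial (Fin n) ℝ), Finset.card_univ, Fintype.card_fin,
      nsmul_eq_mul, mul_one] at this
    rw [← add_mul, this]
  · intro i _
    rw [deriv_prod_eigen _ _ _ (fun j => (1 + 1))]
    intro j _
    rw [Derivation.leibniz_pow, map_sub, mkDerivation_X, mkDerivation_X]
    simp only [smul_eq_mul, nsmul_eq_mul]; push_cast; ring

open MvPolynomial in
lemma sq_VV (n : ℕ) :
    ∑ i, X i ^ 2 * pderiv i (VV n) + 2 * ((∑ i, X i) * VV n) =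
      (2 * (n : MvPolynomial (Fin n) ℝ)) * ((∑ i, X i) * VV n) := by
  rw [mkD_eq _ (fun i => X i ^ 2), VV, deriv_prod_eigen _ _ _
    (fun i => ∑ j ∈ Finset.Ioi i, 2 * (X i + X j))]
  · have := sum_pairs n (fun i => (X i : MvPolynomial (Fin n) ℝ))
    simp only [← Finset.mul_sum]
    linear_combination (2 * ∏ i : Fin n, ∏ j ∈ Finset.Ioi i,
      ((X i : MvPolynomial (Fin n) ℝ) - X j) ^ 2) * this
  · intro i _
    rw [deriv_prod_eigen _ _ _ (fun j => 2 * (X i + X j))]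
    intro j _
    rw [Derivation.leibniz_pow, map_sub, mkDerivation_X, mkDerivation_X]
    simp only [smul_eq_mul, nsmul_eq_mul]; push_cast; ring

open MvPolynomial in
lemma hsDensity_eq (m : ℕ) (α : ℝ) (y : Fin m → ℝ) :
    hsDensity m α y = eval (simplexExt m y) (VV (m+1)) * dirF m (fun _ => α) y := by
  unfold hsDensity dirF VV
  by_cases h : y ∈ {y : Fin m → ℝ | ∀ i, 0 ≤ simplexExt m y i}
  · rw [Set.indicator_of_mem h, Set.indicator_of_mem h]
    simp [map_prod, mul_comm]
  · rw [Set.indicator_of_notMem h, Set.indicator_of_notMem h, mul_zero]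

open MvPolynomial in
lemma SS_main (m : ℕ) (α : ℝ) (hα : 0 ≤ α) :
    ((m + 1) * ((m + 1) + α) + 1) * SS m α hα ((∑ i, X i ^ 2) * VV (m+1)) =
      (2 * (m + 1) + α) * SS m α hα ((∑ i, X i) * VV (m+1)) := by
  have h : ∀ i : Fin (m+1), ((m + 1) * ((m + 1) + α) + 1) * SS m α hα (X i ^ 2 * VV (m+1)) =
      SS m α hα ((α + 2) • (X i * VV (m+1)) + X i ^ 2 * pderiv i (VV (m+1))) := by
    intro i
    have h1 := SS_key m α hα i (X i * VV (m+1))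
    have h2 : ∑ j, X j * pderiv j (X i * VV (m+1)) =
        X i * VV (m+1) + X i * ∑ j, X j * pderiv j (VV (m+1)) := by
      rw [mkD_eq, mkD_eq, Derivation.leibniz, mkDerivation_X]
      simp only [smul_eq_mul]; ring
    have h3 := euler_VV (m+1)
    have h4 : X i * (∑ j, X j * pderiv j (X i * VV (m+1)) +
        (((m:ℝ)+1) * (α + 1)) • (X i * VV (m+1))) =
        (((m:ℝ) + 1) * ((m + 1) + α) + 1) • (X i ^ 2 * VV (m+1)) := by
      rw [h2]
      simp only [smul_eq_C_mul, map_add, map_mul, map_one, map_natCast]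
      push_cast at h3
      linear_combination X i ^ 2 * h3
    have h5 : (α + 1) • (X i * VV (m+1)) + X i * pderiv i (X i * VV (m+1)) =
        (α + 2) • (X i * VV (m+1)) + X i ^ 2 * pderiv i (VV (m+1)) := by
      rw [Derivation.leibniz, pderiv_X_self]
      simp only [smul_eq_C_mul, smul_eq_mul, map_add, map_one, map_ofNat]
      ring
    rw [h4, h5, map_smul, smul_eq_mul] at h1
    exact h1
  rw [Finset.sum_mul, map_sum, Finset.mul_sum, Finset.sum_congr rfl fun i _ => h i, ← map_sum,
    ← smul_eq_mul, ← map_smul]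
  congr 1
  have h6 := sq_VV (m+1)
  rw [Finset.sum_add_distrib, ← Finset.smul_sum, ← Finset.sum_mul]
  simp only [smul_eq_C_mul, map_add, map_mul, map_one, map_natCast, map_ofNat]
  push_cast at h6
  linear_combination h6

theorem hilbert_schmidt_average_purity (m : ℕ) (α : ℝ) (hα : 0 ≤ α) :
    (∫ y : Fin m → ℝ, (∑ i, simplexExt m y i ^ 2) * hsDensity m α y) =
      ((2 * (m + 1) + α) / ((m + 1) * ((m + 1) + α) + 1)) *
        ∫ y : Fin m → ℝ, hsDensity m α y := by
  have h := SS_main m α hα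
  rw [SS_apply, SS_apply] at h
  simp only [map_mul, map_sum, map_pow, MvPolynomial.eval_X, sum_simplexExt, one_mul, mul_assoc,
    ← hsDensity_eq] at h
  have : ((m:ℝ) + 1) * ((m + 1) + α) + 1 ≠ 0 := by positivity
  rw [div_mul_eq_mul_div, eq_div_iff this, ← h]
  ring
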